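/- arXiv:1909.05119 — 11 statements merged into one kernel-verified Lean document; each statement's English description precedes it below -/
import Mathlib

section
/- For all (t,s) ∈ ℝ², the hermitian inner products ⟪F_t(t,s), F(t,s)⟫ = 0 and ⟪F_s(t,s), F(t,s)⟫ = 0; that is, the Calabi torus immersion F is a Legendrian immersion into S⁵ (its tangent vectors are tangent to the sphere and annihilated by the standard contact form of S⁵). -/
/-- The hermitian inner product `⟪z,w⟫ = Σⱼ zⱼ · conj(wⱼ)` on `ℂⁿ`. -/
noncomputable def herm {n : ℕ} (z w : Fin n → ℂ) : ℂ :=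
  ∑ j, z j * (starRingEnd ℂ) (w j)

/-- A curve with components `c j * exp (I * φ j x)` pairs with its derivative to
`I * ∑ j, φ' j * c j ^ 2`. -/
theorem herm_deriv_mul_exp {n : ℕ} (c a : Fin n → ℝ) (φ : Fin n → ℝ → ℝ) (z : ℝ → Fin n → ℂ)
    (x : ℝ) (hz : ∀ y j, z y j = (c j : ℂ) * Complex.exp (Complex.I * (φ j y : ℂ)))
    (hφ : ∀ j, HasDerivAt (φ j) (a j) x) :
    herm (deriv z x) (z x) = Complex.I * ((∑ j, a j * c j ^ 2 : ℝ) : ℂ) := by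
  have hd : HasDerivAt z (fun j => Complex.I * (a j : ℂ) * z x j) x := by
    rw [hasDerivAt_pi]
    intro j
    simp only [hz]
    refine (((hφ j).ofReal_comp.const_mul Complex.I).cexp.const_mul (c j : ℂ)).congr_deriv ?_
    ring
  have hnorm (j : Fin n) : z x j * (starRingEnd ℂ) (z x j) = (c j : ℂ) ^ 2 := by
    rw [Complex.mul_conj', hz, norm_mul, mul_comm Complex.I, Complex.norm_exp_ofReal_mul_I,
      mul_one, Complex.norm_real, Real.norm_eq_abs, ← Complex.ofReal_pow, sq_abs,
      Complex.ofReal_pow]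
  rw [hd.deriv, herm]
  push_cast
  rw [Finset.mul_sum]
  refine Finset.sum_congr rfl fun j _ => ?_
  rw [mul_assoc, hnorm, mul_assoc]

/-- For all `(t,s) ∈ ℝ²`, `⟪F_t,F⟫ = 0` and `⟪F_s,F⟫ = 0`; i.e. the
Calabi torus immersion `F` is a Legendrian immersion into `S⁵`. -/
theorem calabi_torus_is_legendrian
    (r₁ r₂ r₃ r₄ : ℝ) (hr₁ : 0 < r₁) (hr₂ : 0 < r₂) (hr₃ : 0 < r₃) (hr₄ : 0 < r₄)
    (h12 : r₁ ^ 2 + r₂ ^ 2 = 1) (h34 : r₃ ^ 2 + r₄ ^ 2 = 1)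
    (F : ℝ → ℝ → Fin 3 → ℂ)
    (hF : ∀ t s : ℝ, F t s =
      ![((r₁ * r₃ : ℝ) : ℂ) * Complex.exp (Complex.I * (((r₂ / r₁) * t + (r₄ / r₃) * s : ℝ) : ℂ)),
        ((r₁ * r₄ : ℝ) : ℂ) * Complex.exp (Complex.I * (((r₂ / r₁) * t - (r₃ / r₄) * s : ℝ) : ℂ)),
        ((r₂ : ℝ) : ℂ) * Complex.exp (-Complex.I * (((r₁ / r₂) * t : ℝ) : ℂ))])
    (Ft Fs : ℝ → ℝ → Fin 3 → ℂ)
    (hFt : ∀ t s : ℝ, Ft t s = deriv (fun t' => F t' s) t)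
    (hFs : ∀ t s : ℝ, Fs t s = deriv (fun s' => F t s') s) :
    ∀ t s : ℝ, herm (Ft t s) (F t s) = 0 ∧ herm (Fs t s) (F t s) = 0 := by
  intro t s
  have hF' (t s : ℝ) (j : Fin 3) : F t s j = ((![r₁ * r₃, r₁ * r₄, r₂] j : ℝ) : ℂ) *
      Complex.exp (Complex.I * ((![(r₂ / r₁) * t + (r₄ / r₃) * s, (r₂ / r₁) * t - (r₃ / r₄) * s,
        -((r₁ / r₂) * t)] j : ℝ) : ℂ)) := by
    rw [hF]
    fin_cases j <;> simp
  rw [hFt, hFs]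
  constructor
  · rw [herm_deriv_mul_exp ![r₁ * r₃, r₁ * r₄, r₂] ![r₂ / r₁, r₂ / r₁, -(r₁ / r₂)]
      (fun j t => ![(r₂ / r₁) * t + (r₄ / r₃) * s, (r₂ / r₁) * t - (r₃ / r₄) * s,
        -((r₁ / r₂) * t)] j) (fun t => F t s) t (fun t j => hF' t s j)]
    · have h : r₂ / r₁ * (r₁ * r₃) ^ 2 + r₂ / r₁ * (r₁ * r₄) ^ 2 + -(r₁ / r₂) * r₂ ^ 2 = 0 := by
        field_simp
        linear_combination r₂ * r₁ * h34
      simp only [Fin.sum_univ_three, Matrix.cons_val, h, Complex.ofReal_zero, mul_zero]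
    · intro j
      fin_cases j
      · simpa using ((hasDerivAt_id t).const_mul (r₂ / r₁)).add_const (r₄ / r₃ * s)
      · simpa using ((hasDerivAt_id t).const_mul (r₂ / r₁)).sub_const (r₃ / r₄ * s)
      · simpa using (hasDerivAt_id t).const_mul (-(r₁ / r₂))
  · rw [herm_deriv_mul_exp ![r₁ * r₃, r₁ * r₄, r₂] ![r₄ / r₃, -(r₃ / r₄), 0]
      (fun j s => ![(r₂ / r₁) * t + (r₄ / r₃) * s, (r₂ / r₁) * t - (r₃ / r₄) * s,
        -((r₁ / r₂) * t)] j) (fun s => F t s) s (fun s j => hF' t s j)]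
    · have h : r₄ / r₃ * (r₁ * r₃) ^ 2 + -(r₃ / r₄) * (r₁ * r₄) ^ 2 + 0 * r₂ ^ 2 = 0 := by
        field_simp
        ring
      simp only [Fin.sum_univ_three, Matrix.cons_val, h, Complex.ofReal_zero, mul_zero]
    · intro j
      fin_cases j
      · simpa using ((hasDerivAt_id s).const_mul (r₄ / r₃)).const_add (r₂ / r₁ * t)
      · simpa using ((hasDerivAt_id s).const_mul (r₃ / r₄)).const_sub (r₂ / r₁ * t)
      · simpa using hasDerivAt_const s (-(r₁ / r₂ * t))
end

section
/- All second partial derivatives of F are normal to the immersed surface: for every a,b ∈ {t,s} and every (t,s) ∈ ℝ², Re⟪∂_a∂_b F, F_t⟫ = 0 and Re⟪∂_a∂_b F, F_s⟫ = 0. (Equivalently, the unit tangent frame E₁ = F_t, E₂ = F_s/r₁ is parallel with respect to the induced metric.) -/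
/-- The map `ℝ² → ℂⁿ` whose `j`-th coordinate is `cⱼ · exp (i (αⱼ t + βⱼ s))`. -/
noncomputable def planeWave {n : ℕ} (α β : Fin n → ℝ) (c : Fin n → ℂ) (t s : ℝ) : Fin n → ℂ :=
  fun j => c j * Complex.exp (Complex.I * ((α j * t + β j * s : ℝ) : ℂ))

theorem planeWave_swap {n : ℕ} (α β : Fin n → ℝ) (c : Fin n → ℂ) (t s : ℝ) :
    planeWave α β c t s = planeWave β α c s t := by
  funext j
  simp only [planeWave, add_comm]

theorem deriv_planeWave_left {n : ℕ} (α β : Fin n → ℝ) (c : Fin n → ℂ) (t s : ℝ) :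
    deriv (fun t' => planeWave α β c t' s) t =
      planeWave α β (fun j => c j * (Complex.I * α j)) t s := by
  refine HasDerivAt.deriv (hasDerivAt_pi.2 fun j => ?_)
  have h : HasDerivAt (fun t' : ℝ => α j * t' + β j * s) (α j) t := by
    simpa using ((hasDerivAt_id t).const_mul (α j)).add_const (β j * s)
  refine ((h.ofReal_comp.const_mul Complex.I).cexp.const_mul (c j)).congr_deriv ?_
  simp only [planeWave]
  ring

theorem deriv_planeWave_right {n : ℕ} (α β : Fin n → ℝ) (c : Fin n → ℂ) (t s : ℝ) :
    deriv (fun s' => planeWave α β c t s') s =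
      planeWave α β (fun j => c j * (Complex.I * β j)) t s := by
  simp only [planeWave_swap α β]
  exact deriv_planeWave_left β α c s t

/-- For real amplitudes, the second derivatives of a plane wave are orthogonal to its first
derivatives with respect to the real inner product. -/
theorem re_herm_planeWave_eq_zero {n : ℕ} (α β c p q r : Fin n → ℝ) (t s : ℝ) :
    (herm (planeWave α β (fun j => (c j : ℂ) * (Complex.I * p j) * (Complex.I * q j)) t s)
      (planeWave α β (fun j => (c j : ℂ) * (Complex.I * r j)) t s)).re = 0 := by
  rw [herm, Complex.re_sum]
  refine Finset.sum_eq_zero fun j _ => ?_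
  simp only [planeWave, map_mul]
  generalize Complex.exp _ = z
  simp
  ring

/-- all second partial derivatives of the Calabi torus immersion `F`
are normal to the surface: for every `a,b ∈ {t,s}`, `Re⟪∂_a∂_b F, F_t⟫ = 0` and
`Re⟪∂_a∂_b F, F_s⟫ = 0`. -/
theorem calabi_torus_second_derivatives_normal
    (r₁ r₂ r₃ r₄ : ℝ) (hr₁ : 0 < r₁) (hr₂ : 0 < r₂) (hr₃ : 0 < r₃) (hr₄ : 0 < r₄)
    (h12 : r₁ ^ 2 + r₂ ^ 2 = 1) (h34 : r₃ ^ 2 + r₄ ^ 2 = 1)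
    (F : ℝ → ℝ → Fin 3 → ℂ)
    (hF : ∀ t s : ℝ, F t s =
      ![((r₁ * r₃ : ℝ) : ℂ) * Complex.exp (Complex.I * (((r₂ / r₁) * t + (r₄ / r₃) * s : ℝ) : ℂ)),
        ((r₁ * r₄ : ℝ) : ℂ) * Complex.exp (Complex.I * (((r₂ / r₁) * t - (r₃ / r₄) * s : ℝ) : ℂ)),
        ((r₂ : ℝ) : ℂ) * Complex.exp (-Complex.I * (((r₁ / r₂) * t : ℝ) : ℂ))])
    (Ft Fs Ftt Fts Fst Fss : ℝ → ℝ → Fin 3 → ℂ)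
    (hFt : ∀ t s : ℝ, Ft t s = deriv (fun t' => F t' s) t)
    (hFs : ∀ t s : ℝ, Fs t s = deriv (fun s' => F t s') s)
    (hFtt : ∀ t s : ℝ, Ftt t s = deriv (fun t' => Ft t' s) t)
    (hFts : ∀ t s : ℝ, Fts t s = deriv (fun s' => Ft t s') s)
    (hFst : ∀ t s : ℝ, Fst t s = deriv (fun t' => Fs t' s) t)
    (hFss : ∀ t s : ℝ, Fss t s = deriv (fun s' => Fs t s') s) :
    ∀ t s : ℝ, ∀ D ∈ [Ftt, Fts, Fst, Fss],
      (herm (D t s) (Ft t s)).re = 0 ∧ (herm (D t s) (Fs t s)).re = 0 := by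
  set α : Fin 3 → ℝ := ![r₂ / r₁, r₂ / r₁, -(r₁ / r₂)] with hα
  set β : Fin 3 → ℝ := ![r₄ / r₃, -(r₃ / r₄), 0] with hβ
  set c : Fin 3 → ℝ := ![r₁ * r₃, r₁ * r₄, r₂] with hc
  have hF' : ∀ t s, F t s = planeWave α β (fun j => (c j : ℂ)) t s := by
    intro t s
    rw [hF]
    funext j
    fin_cases j <;> simp [planeWave, hα, hβ, hc, sub_eq_add_neg]
  simp only [hF', deriv_planeWave_left] at hFt
  simp only [hF', deriv_planeWave_right] at hFs
  simp only [hFt, deriv_planeWave_left] at hFtt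
  simp only [hFt, deriv_planeWave_right] at hFts
  simp only [hFs, deriv_planeWave_left] at hFst
  simp only [hFs, deriv_planeWave_right] at hFss
  intro t s D hD
  simp only [List.mem_cons, List.not_mem_nil, or_false] at hD
  rcases hD with rfl | rfl | rfl | rfl <;>
    simp only [hFt, hFs, hFtt, hFts, hFst, hFss, re_herm_planeWave_eq_zero, and_self]
end

section
/- The second fundamental form of the Calabi torus has no component along the Reeb field R = −iF: for every a,b ∈ {t,s} and every (t,s) ∈ ℝ², Re⟪∂_a∂_b F(t,s), i·F(t,s)⟫ = 0. -/
/-- The map `(t, s) ↦ (cⱼ exp(i(αⱼ t + βⱼ s)))ⱼ`, whose image lies on a product of circles. -/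
noncomputable def phaseMap {n : ℕ} (c : Fin n → ℂ) (α β : Fin n → ℝ) (t s : ℝ) : Fin n → ℂ :=
  fun j => c j * Complex.exp (Complex.I * ((α j * t + β j * s : ℝ) : ℂ))

theorem deriv_phaseMap_left {n : ℕ} (c : Fin n → ℂ) (α β : Fin n → ℝ) (t s : ℝ) :
    deriv (fun t' => phaseMap c α β t' s) t =
      phaseMap (fun j => Complex.I * α j * c j) α β t s := by
  refine HasDerivAt.deriv (hasDerivAt_pi.2 fun j => ?_)
  have h : HasDerivAt (fun x : ℝ => α j * x + β j * s) (α j) t := by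
    simpa using ((hasDerivAt_id t).const_mul (α j)).add_const (β j * s)
  refine HasDerivAt.congr_deriv (((h.ofReal_comp.const_mul Complex.I).cexp).const_mul (c j)) ?_
  simp only [phaseMap]
  ring

theorem phaseMap_swap {n : ℕ} (c : Fin n → ℂ) (α β : Fin n → ℝ) (t s : ℝ) :
    phaseMap c α β t s = phaseMap c β α s t := by
  ext j
  simp only [phaseMap, add_comm]

theorem deriv_phaseMap_right {n : ℕ} (c : Fin n → ℂ) (α β : Fin n → ℝ) (t s : ℝ) :
    deriv (fun s' => phaseMap c α β t s') s =
      phaseMap (fun j => Complex.I * β j * c j) α β t s := by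
  simp only [phaseMap_swap c α β t, deriv_phaseMap_left, phaseMap_swap _ β α s]

theorem herm_phaseMap_second_deriv_re {n : ℕ} (c : Fin n → ℂ) (α β μ ν : Fin n → ℝ) (t s : ℝ) :
    (herm (phaseMap (fun j => Complex.I * μ j * (Complex.I * ν j * c j)) α β t s)
      (fun j => Complex.I * phaseMap c α β t s j)).re = 0 := by
  simp only [herm, Complex.re_sum]
  refine Finset.sum_eq_zero fun j _ => ?_
  set z := phaseMap c α β t s j with hz
  have h : phaseMap (fun j => Complex.I * μ j * (Complex.I * ν j * c j)) α β t s j =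
      ((-(μ j * ν j) : ℝ) : ℂ) * z := by
    simp only [hz, phaseMap]
    push_cast
    linear_combination (μ j * ν j * c j *
      Complex.exp (Complex.I * (α j * t + β j * s)) : ℂ) * Complex.I_mul_I
  rw [h]
  simp only [map_mul, Complex.conj_I, Complex.mul_re, Complex.mul_im, Complex.neg_re,
    Complex.neg_im, Complex.I_re, Complex.I_im, Complex.conj_re, Complex.conj_im,
    Complex.ofReal_re, Complex.ofReal_im]
  ring

/-- the second fundamental form of the Calabi torus has no component
along the Reeb field `R = −iF`: for every `a,b ∈ {t,s}`, `Re⟪∂_a∂_b F, i·F⟫ = 0`. -/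
theorem calabi_torus_no_reeb_component
    (r₁ r₂ r₃ r₄ : ℝ) (hr₁ : 0 < r₁) (hr₂ : 0 < r₂) (hr₃ : 0 < r₃) (hr₄ : 0 < r₄)
    (h12 : r₁ ^ 2 + r₂ ^ 2 = 1) (h34 : r₃ ^ 2 + r₄ ^ 2 = 1)
    (F : ℝ → ℝ → Fin 3 → ℂ)
    (hF : ∀ t s : ℝ, F t s =
      ![((r₁ * r₃ : ℝ) : ℂ) * Complex.exp (Complex.I * (((r₂ / r₁) * t + (r₄ / r₃) * s : ℝ) : ℂ)),
        ((r₁ * r₄ : ℝ) : ℂ) * Complex.exp (Complex.I * (((r₂ / r₁) * t - (r₃ / r₄) * s : ℝ) : ℂ)),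
        ((r₂ : ℝ) : ℂ) * Complex.exp (-Complex.I * (((r₁ / r₂) * t : ℝ) : ℂ))])
    (Ft Fs Ftt Fts Fst Fss : ℝ → ℝ → Fin 3 → ℂ)
    (hFt : ∀ t s : ℝ, Ft t s = deriv (fun t' => F t' s) t)
    (hFs : ∀ t s : ℝ, Fs t s = deriv (fun s' => F t s') s)
    (hFtt : ∀ t s : ℝ, Ftt t s = deriv (fun t' => Ft t' s) t)
    (hFts : ∀ t s : ℝ, Fts t s = deriv (fun s' => Ft t s') s)
    (hFst : ∀ t s : ℝ, Fst t s = deriv (fun t' => Fs t' s) t)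
    (hFss : ∀ t s : ℝ, Fss t s = deriv (fun s' => Fs t s') s) :
    ∀ t s : ℝ, ∀ D ∈ [Ftt, Fts, Fst, Fss],
      (herm (D t s) (fun j => Complex.I * F t s j)).re = 0 := by
  obtain ⟨c, α, β, hc⟩ : ∃ (c : Fin 3 → ℂ) (α β : Fin 3 → ℝ),
      ∀ t s, F t s = phaseMap c α β t s := by
    refine ⟨![((r₁ * r₃ : ℝ) : ℂ), ((r₁ * r₄ : ℝ) : ℂ), (r₂ : ℂ)],
      ![r₂ / r₁, r₂ / r₁, -(r₁ / r₂)], ![r₄ / r₃, -(r₃ / r₄), 0], fun t s => ?_⟩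
    rw [hF]
    ext j
    fin_cases j <;> simp [phaseMap, sub_eq_add_neg]
  intro t s D hD
  simp only [hc, deriv_phaseMap_left, deriv_phaseMap_right] at hFt hFs
  simp only [hFt, deriv_phaseMap_left, deriv_phaseMap_right] at hFtt hFts
  simp only [hFs, deriv_phaseMap_left, deriv_phaseMap_right] at hFst hFss
  simp only [List.mem_cons, List.not_mem_nil, or_false] at hD
  rcases hD with rfl | rfl | rfl | rfl <;>
    simp only [hc, hFtt, hFts, hFst, hFss, herm_phaseMap_second_deriv_re]
end

section
/- The components of the second fundamental form of the Calabi torus along the unit normal ν₁ = i·F_t are: Re⟪F_tt, i·F_t⟫ = r₂/r₁ − r₁/r₂, Re⟪F_ts, i·F_t⟫ = 0, and Re⟪F_ss, i·F_t⟫ = r₁r₂, at every point of ℝ². -/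
/-- The map `ℝ² → ℂⁿ` whose `j`-th component is `cⱼ · exp(i(aⱼ t + bⱼ s))`. -/
noncomputable def expWave {n : ℕ} (a b : Fin n → ℝ) (c : Fin n → ℂ) (t s : ℝ) : Fin n → ℂ :=
  fun j => c j * Complex.exp (Complex.I * ((a j * t + b j * s : ℝ) : ℂ))

lemma hasDerivAt_mul_exp_I_mul {f : ℝ → ℝ} {f' x : ℝ} (c : ℂ) (hf : HasDerivAt f f' x) :
    HasDerivAt (fun y => c * Complex.exp (Complex.I * (f y : ℂ)))
      (Complex.I * f' * c * Complex.exp (Complex.I * (f x : ℂ))) x := by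
  exact ((hf.ofReal_comp.const_mul Complex.I).cexp.const_mul c).congr_deriv (by ring)

lemma deriv_expWave_left {n : ℕ} (a b : Fin n → ℝ) (c : Fin n → ℂ) (t s : ℝ) :
    deriv (fun t' => expWave a b c t' s) t =
      expWave a b (fun j => Complex.I * a j * c j) t s := by
  refine (hasDerivAt_pi.2 fun j => ?_).deriv
  refine hasDerivAt_mul_exp_I_mul (c j) ?_
  simpa using ((hasDerivAt_id t).const_mul (a j)).add_const (b j * s)

lemma deriv_expWave_right {n : ℕ} (a b : Fin n → ℝ) (c : Fin n → ℂ) (t s : ℝ) :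
    deriv (fun s' => expWave a b c t s') s =
      expWave a b (fun j => Complex.I * b j * c j) t s := by
  refine (hasDerivAt_pi.2 fun j => ?_).deriv
  refine hasDerivAt_mul_exp_I_mul (c j) ?_
  simpa using ((hasDerivAt_id s).const_mul (b j)).const_add (a j * t)

lemma herm_expWave {n : ℕ} (a b : Fin n → ℝ) (c d : Fin n → ℂ) (t s : ℝ) :
    herm (expWave a b c t s) (fun j => Complex.I * expWave a b d t s j) =
      herm c (fun j => Complex.I * d j) := by
  refine Finset.sum_congr rfl fun j _ => ?_
  have h : Complex.exp (Complex.I * ((a j * t + b j * s : ℝ) : ℂ)) *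
      (starRingEnd ℂ) (Complex.exp (Complex.I * ((a j * t + b j * s : ℝ) : ℂ))) = 1 := by
    rw [← Complex.exp_conj, ← Complex.exp_add]
    simp
  simp only [expWave, map_mul]
  linear_combination (c j * ((starRingEnd ℂ) Complex.I * (starRingEnd ℂ) (d j))) * h

/-- the components of the second fundamental form of the Calabi torus
along the unit normal `ν₁ = i·F_t`: `Re⟪F_tt, i·F_t⟫ = r₂/r₁ − r₁/r₂`,
`Re⟪F_ts, i·F_t⟫ = 0` and `Re⟪F_ss, i·F_t⟫ = r₁r₂`. -/
theorem calabi_torus_second_fundamental_form_nu_one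
    (r₁ r₂ r₃ r₄ : ℝ) (hr₁ : 0 < r₁) (hr₂ : 0 < r₂) (hr₃ : 0 < r₃) (hr₄ : 0 < r₄)
    (h12 : r₁ ^ 2 + r₂ ^ 2 = 1) (h34 : r₃ ^ 2 + r₄ ^ 2 = 1)
    (F : ℝ → ℝ → Fin 3 → ℂ)
    (hF : ∀ t s : ℝ, F t s =
      ![((r₁ * r₃ : ℝ) : ℂ) * Complex.exp (Complex.I * (((r₂ / r₁) * t + (r₄ / r₃) * s : ℝ) : ℂ)),
        ((r₁ * r₄ : ℝ) : ℂ) * Complex.exp (Complex.I * (((r₂ / r₁) * t - (r₃ / r₄) * s : ℝ) : ℂ)),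
        ((r₂ : ℝ) : ℂ) * Complex.exp (-Complex.I * (((r₁ / r₂) * t : ℝ) : ℂ))])
    (Ft Fs Ftt Fts Fss : ℝ → ℝ → Fin 3 → ℂ)
    (hFt : ∀ t s : ℝ, Ft t s = deriv (fun t' => F t' s) t)
    (hFs : ∀ t s : ℝ, Fs t s = deriv (fun s' => F t s') s)
    (hFtt : ∀ t s : ℝ, Ftt t s = deriv (fun t' => Ft t' s) t)
    (hFts : ∀ t s : ℝ, Fts t s = deriv (fun s' => Ft t s') s)
    (hFss : ∀ t s : ℝ, Fss t s = deriv (fun s' => Fs t s') s) :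
    ∀ t s : ℝ,
      (herm (Ftt t s) (fun j => Complex.I * Ft t s j)).re = r₂ / r₁ - r₁ / r₂ ∧
      (herm (Fts t s) (fun j => Complex.I * Ft t s j)).re = 0 ∧
      (herm (Fss t s) (fun j => Complex.I * Ft t s j)).re = r₁ * r₂ := by
  set a : Fin 3 → ℝ := ![r₂ / r₁, r₂ / r₁, -(r₁ / r₂)] with ha
  set b : Fin 3 → ℝ := ![r₄ / r₃, -(r₃ / r₄), 0] with hb
  set c : Fin 3 → ℂ := ![((r₁ * r₃ : ℝ) : ℂ), ((r₁ * r₄ : ℝ) : ℂ), (r₂ : ℂ)] with hc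
  have hF' : F = expWave a b c := by
    funext t s j
    rw [hF]
    fin_cases j <;> simp [expWave, ha, hb, hc, sub_eq_add_neg]
  have hFt' : Ft = expWave a b (fun j => Complex.I * a j * c j) := by
    funext t s
    rw [hFt, hF', deriv_expWave_left]
  have hFs' : Fs = expWave a b (fun j => Complex.I * b j * c j) := by
    funext t s
    rw [hFs, hF', deriv_expWave_right]
  intro t s
  rw [hFtt, hFts, hFss, hFt', hFs', deriv_expWave_left, deriv_expWave_right,
    deriv_expWave_right, herm_expWave, herm_expWave, herm_expWave]
  simp only [herm, Fin.sum_univ_three, ha, hb, hc]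
  refine ⟨?_, ?_, ?_⟩
  · simp [-Complex.ofReal_div]
    linear_combination (norm := field) r₂ ^ 3 / r₁ * h34 + (r₂ ^ 2 - r₁ ^ 2) / (r₁ * r₂) * h12
  · simp [-Complex.ofReal_div]
    field
  · simp [-Complex.ofReal_div]
    linear_combination (norm := field) r₁ * r₂ * h34
end

section
/- The components of the second fundamental form of the Calabi torus along the normal i·F_s are: Re⟪F_tt, i·F_s⟫ = 0, Re⟪F_ts, i·F_s⟫ = r₁r₂, and Re⟪F_ss, i·F_s⟫ = r₁²(r₄/r₃ − r₃/r₄), at every point of ℝ². -/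
/-- The orbit map `(t, s) ↦ (cⱼ · exp(i(aⱼt + bⱼs)))ⱼ` of a linear torus action on `ℂⁿ`. -/
noncomputable def linearOrbit {n : ℕ} (a b : Fin n → ℝ) (c : Fin n → ℂ) (t s : ℝ) : Fin n → ℂ :=
  fun j => c j * Complex.exp (Complex.I * ((a j * t + b j * s : ℝ) : ℂ))

theorem deriv_linearOrbit_left {n : ℕ} (a b : Fin n → ℝ) (c : Fin n → ℂ) (t s : ℝ) :
    deriv (fun t' => linearOrbit a b c t' s) t =
      linearOrbit a b (fun j => Complex.I * a j * c j) t s := by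
  refine HasDerivAt.deriv (hasDerivAt_pi.2 fun j => ?_)
  have h : HasDerivAt (fun t' : ℝ => a j * t' + b j * s) (a j) t := by
    simpa using ((hasDerivAt_id t).const_mul (a j)).add_const (b j * s)
  refine (((h.ofReal_comp.const_mul Complex.I).cexp).const_mul (c j)).congr_deriv ?_
  simp only [linearOrbit]
  ring

theorem linearOrbit_swap {n : ℕ} (a b : Fin n → ℝ) (c : Fin n → ℂ) (t s : ℝ) :
    linearOrbit a b c t s = linearOrbit b a c s t := by
  funext j
  unfold linearOrbit
  rw [add_comm]

theorem deriv_linearOrbit_right {n : ℕ} (a b : Fin n → ℝ) (c : Fin n → ℂ) (t s : ℝ) :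
    deriv (fun s' => linearOrbit a b c t s') s =
      linearOrbit a b (fun j => Complex.I * b j * c j) t s := by
  simp_rw [linearOrbit_swap a b]
  exact deriv_linearOrbit_left b a c s t

theorem herm_linearOrbit {n : ℕ} (a b : Fin n → ℝ) (c d : Fin n → ℂ) (t s : ℝ) :
    herm (linearOrbit a b c t s) (fun j => Complex.I * linearOrbit a b d t s j) =
      herm c (fun j => Complex.I * d j) := by
  refine Finset.sum_congr rfl fun j _ => ?_
  have h : Complex.exp (Complex.I * ((a j * t + b j * s : ℝ) : ℂ)) *
      (starRingEnd ℂ) (Complex.exp (Complex.I * ((a j * t + b j * s : ℝ) : ℂ))) = 1 := by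
    rw [← Complex.exp_conj, ← Complex.exp_add, map_mul, Complex.conj_I, Complex.conj_ofReal,
      neg_mul, add_neg_cancel, Complex.exp_zero]
  simp only [linearOrbit, map_mul]
  linear_combination c j * (starRingEnd ℂ) Complex.I * (starRingEnd ℂ) (d j) * h

/-- the components of the second fundamental form of the Calabi torus
along the normal `i·F_s`: `Re⟪F_tt, i·F_s⟫ = 0`, `Re⟪F_ts, i·F_s⟫ = r₁r₂` and
`Re⟪F_ss, i·F_s⟫ = r₁²(r₄/r₃ − r₃/r₄)`. -/
theorem calabi_torus_second_fundamental_form_nu_two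
    (r₁ r₂ r₃ r₄ : ℝ) (hr₁ : 0 < r₁) (hr₂ : 0 < r₂) (hr₃ : 0 < r₃) (hr₄ : 0 < r₄)
    (h12 : r₁ ^ 2 + r₂ ^ 2 = 1) (h34 : r₃ ^ 2 + r₄ ^ 2 = 1)
    (F : ℝ → ℝ → Fin 3 → ℂ)
    (hF : ∀ t s : ℝ, F t s =
      ![((r₁ * r₃ : ℝ) : ℂ) * Complex.exp (Complex.I * (((r₂ / r₁) * t + (r₄ / r₃) * s : ℝ) : ℂ)),
        ((r₁ * r₄ : ℝ) : ℂ) * Complex.exp (Complex.I * (((r₂ / r₁) * t - (r₃ / r₄) * s : ℝ) : ℂ)),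
        ((r₂ : ℝ) : ℂ) * Complex.exp (-Complex.I * (((r₁ / r₂) * t : ℝ) : ℂ))])
    (Ft Fs Ftt Fts Fss : ℝ → ℝ → Fin 3 → ℂ)
    (hFt : ∀ t s : ℝ, Ft t s = deriv (fun t' => F t' s) t)
    (hFs : ∀ t s : ℝ, Fs t s = deriv (fun s' => F t s') s)
    (hFtt : ∀ t s : ℝ, Ftt t s = deriv (fun t' => Ft t' s) t)
    (hFts : ∀ t s : ℝ, Fts t s = deriv (fun s' => Ft t s') s)
    (hFss : ∀ t s : ℝ, Fss t s = deriv (fun s' => Fs t s') s) :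
    ∀ t s : ℝ,
      (herm (Ftt t s) (fun j => Complex.I * Fs t s j)).re = 0 ∧
      (herm (Fts t s) (fun j => Complex.I * Fs t s j)).re = r₁ * r₂ ∧
      (herm (Fss t s) (fun j => Complex.I * Fs t s j)).re = r₁ ^ 2 * (r₄ / r₃ - r₃ / r₄) := by
  obtain ⟨a, ha⟩ : ∃ a : Fin 3 → ℝ, a = ![r₂ / r₁, r₂ / r₁, -(r₁ / r₂)] := ⟨_, rfl⟩
  obtain ⟨b, hb⟩ : ∃ b : Fin 3 → ℝ, b = ![r₄ / r₃, -(r₃ / r₄), 0] := ⟨_, rfl⟩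
  obtain ⟨c, hc⟩ : ∃ c : Fin 3 → ℝ, c = ![r₁ * r₃, r₁ * r₄, r₂] := ⟨_, rfl⟩
  have F_eq : ∀ t s, F t s = linearOrbit a b (fun j => (c j : ℂ)) t s := by
    intro t s
    rw [hF]
    ext j
    fin_cases j <;> simp [linearOrbit, ha, hb, hc, sub_eq_add_neg]
  simp only [F_eq, deriv_linearOrbit_left] at hFt
  simp only [F_eq, deriv_linearOrbit_right] at hFs
  simp only [hFt, deriv_linearOrbit_left] at hFtt
  simp only [hFt, deriv_linearOrbit_right] at hFts
  simp only [hFs, deriv_linearOrbit_right] at hFss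
  intro t s
  have herm_re : ∀ u v : Fin 3 → ℝ,
      (herm (fun j => Complex.I * u j * (Complex.I * v j * c j))
        (fun j => Complex.I * (Complex.I * b j * c j))).re = ∑ j, u j * v j * b j * c j ^ 2 := by
    intro u v
    rw [herm, Complex.re_sum]
    refine Finset.sum_congr rfl fun j _ => ?_
    simp
    ring
  rw [hFtt, hFts, hFss, hFs, herm_linearOrbit, herm_linearOrbit, herm_linearOrbit,
    herm_re, herm_re, herm_re]
  simp only [Fin.sum_univ_three, ha, hb, hc, Matrix.cons_val]
  refine ⟨?_, ?_, ?_⟩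
  · field_simp
    ring
  · field_simp
    linear_combination h34
  · field_simp
    linear_combination r₁ ^ 2 * (r₄ ^ 2 - r₃ ^ 2) * h34
end

section
/- The mean curvature vector of the Calabi torus in S⁵ satisfies the identity F_tt + r₁⁻²·F_ss + 2F = (2r₂/r₁ − r₁/r₂)·(i·F_t) + r₁⁻²·(r₄/r₃ − r₃/r₄)·(i·F_s) at every point of ℝ². (The left-hand side is the Laplacian of F with respect to the induced metric dt² + r₁²ds² plus 2F, which equals the mean curvature vector H of F as a surface in S⁵; hence H = (2r₂/r₁ − r₁/r₂)ν₁ + (1/r₁)(r₄/r₃ − r₃/r₄)ν₂ with ν₁ = iF_t and ν₂ = iF_s/r₁.) -/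
/-- The derivative along a real line of a vector of plane waves with frequencies `A j`. -/
theorem deriv_mul_exp_I_mul {ι : Type*} [Fintype ι] (C : ι → ℂ) (A B : ι → ℝ) (x : ℝ) :
    deriv (fun (y : ℝ) (j : ι) => C j * Complex.exp (Complex.I * ((A j * y + B j : ℝ) : ℂ))) x =
      fun j => C j * (Complex.I * A j) *
        Complex.exp (Complex.I * ((A j * x + B j : ℝ) : ℂ)) := by
  refine (hasDerivAt_pi.2 fun j => ?_).deriv
  have h : HasDerivAt (fun y : ℝ => A j * y + B j) (A j) x := by
    simpa using ((hasDerivAt_id x).const_mul (A j)).add_const (B j)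
  exact ((h.ofReal_comp.const_mul Complex.I).cexp.const_mul (C j)).congr_deriv (by ring)


/-- the mean curvature identity of the Calabi torus:
`F_tt + r₁⁻²·F_ss + 2F = (2r₂/r₁ − r₁/r₂)·(i·F_t) + r₁⁻²·(r₄/r₃ − r₃/r₄)·(i·F_s)`,
i.e. the mean curvature vector in `S⁵` is
`H = (2r₂/r₁ − r₁/r₂)ν₁ + (1/r₁)(r₄/r₃ − r₃/r₄)ν₂` with `ν₁ = iF_t`, `ν₂ = iF_s/r₁`. -/
theorem calabi_torus_mean_curvature
    (r₁ r₂ r₃ r₄ : ℝ) (hr₁ : 0 < r₁) (hr₂ : 0 < r₂) (hr₃ : 0 < r₃) (hr₄ : 0 < r₄)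
    (h12 : r₁ ^ 2 + r₂ ^ 2 = 1) (h34 : r₃ ^ 2 + r₄ ^ 2 = 1)
    (F : ℝ → ℝ → Fin 3 → ℂ)
    (hF : ∀ t s : ℝ, F t s =
      ![((r₁ * r₃ : ℝ) : ℂ) * Complex.exp (Complex.I * (((r₂ / r₁) * t + (r₄ / r₃) * s : ℝ) : ℂ)),
        ((r₁ * r₄ : ℝ) : ℂ) * Complex.exp (Complex.I * (((r₂ / r₁) * t - (r₃ / r₄) * s : ℝ) : ℂ)),
        ((r₂ : ℝ) : ℂ) * Complex.exp (-Complex.I * (((r₁ / r₂) * t : ℝ) : ℂ))])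
    (Ft Fs Ftt Fss : ℝ → ℝ → Fin 3 → ℂ)
    (hFt : ∀ t s : ℝ, Ft t s = deriv (fun t' => F t' s) t)
    (hFs : ∀ t s : ℝ, Fs t s = deriv (fun s' => F t s') s)
    (hFtt : ∀ t s : ℝ, Ftt t s = deriv (fun t' => Ft t' s) t)
    (hFss : ∀ t s : ℝ, Fss t s = deriv (fun s' => Fs t s') s) :
    ∀ t s : ℝ, ∀ j : Fin 3,
      Ftt t s j + ((r₁ ^ 2 : ℝ) : ℂ)⁻¹ * Fss t s j + 2 * F t s j =
        ((2 * r₂ / r₁ - r₁ / r₂ : ℝ) : ℂ) * (Complex.I * Ft t s j) +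
          (((r₄ / r₃ - r₃ / r₄) / r₁ ^ 2 : ℝ) : ℂ) * (Complex.I * Fs t s j) := by
  obtain ⟨C, A, B, hE, hAB⟩ : ∃ (C : Fin 3 → ℂ) (A B : Fin 3 → ℝ),
      (∀ t s, F t s = fun j => C j * Complex.exp (Complex.I * ((A j * t + B j * s : ℝ) : ℂ))) ∧
      ∀ j, -A j ^ 2 - (r₁ ^ 2)⁻¹ * B j ^ 2 + 2 =
        -(2 * r₂ / r₁ - r₁ / r₂) * A j - (r₄ / r₃ - r₃ / r₄) / r₁ ^ 2 * B j := by
    refine ⟨![((r₁ * r₃ : ℝ) : ℂ), ((r₁ * r₄ : ℝ) : ℂ), r₂],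
      ![r₂ / r₁, r₂ / r₁, -(r₁ / r₂)], ![r₄ / r₃, -(r₃ / r₄), 0], fun t s => ?_, fun j => ?_⟩
    · rw [hF]
      ext j
      fin_cases j <;> simp [sub_eq_add_neg]
    · fin_cases j <;> simp <;> field_simp
      · linear_combination r₃ ^ 2 * h12
      · linear_combination r₄ ^ 2 * h12
      · ring
  have hFt' : ∀ t s, Ft t s = fun j => C j * (Complex.I * A j) *
      Complex.exp (Complex.I * ((A j * t + B j * s : ℝ) : ℂ)) := fun t s => by
    simp only [hFt, hE]
    exact deriv_mul_exp_I_mul C A (fun j => B j * s) t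
  have hFs' : ∀ t s, Fs t s = fun j => C j * (Complex.I * B j) *
      Complex.exp (Complex.I * ((A j * t + B j * s : ℝ) : ℂ)) := fun t s => by
    simp only [hFs, hE, add_comm (A _ * t)]
    exact deriv_mul_exp_I_mul C B (fun j => A j * t) s
  have hFtt' : ∀ t s, Ftt t s = fun j => C j * (Complex.I * A j) * (Complex.I * A j) *
      Complex.exp (Complex.I * ((A j * t + B j * s : ℝ) : ℂ)) := fun t s => by
    simp only [hFtt, hFt']
    exact deriv_mul_exp_I_mul (fun j => C j * (Complex.I * A j)) A (fun j => B j * s) t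
  have hFss' : ∀ t s, Fss t s = fun j => C j * (Complex.I * B j) * (Complex.I * B j) *
      Complex.exp (Complex.I * ((A j * t + B j * s : ℝ) : ℂ)) := fun t s => by
    simp only [hFss, hFs', add_comm (A _ * t)]
    exact deriv_mul_exp_I_mul (fun j => C j * (Complex.I * B j)) B (fun j => A j * t) s
  intro t s j
  have key := congrArg (fun x : ℝ => (x : ℂ)) (hAB j)
  simp only [hFtt', hFss', hFt', hFs', hE]
  generalize Complex.exp (Complex.I * ((A j * t + B j * s : ℝ) : ℂ)) = E
  push_cast at key ⊢
  linear_combination C j * E * key + C j * E * ((A j : ℂ) ^ 2 + ((r₁ : ℂ) ^ 2)⁻¹ * B j ^ 2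
    - (2 * r₂ / r₁ - r₁ / r₂) * A j - (r₄ / r₃ - r₃ / r₄) / r₁ ^ 2 * B j) * Complex.I_sq
end

section
/- For all (x,y) ∈ ℝ², the hermitian inner products ⟪F_x(x,y), F(x,y)⟫ = 0 and ⟪F_y(x,y), F(x,y)⟫ = 0; that is, Mironov's immersion F is a Legendrian immersion into S⁵. -/
theorem Complex.exp_I_mul_ofReal_mul_conj (t : ℝ) :
    Complex.exp (Complex.I * (t : ℂ)) * (starRingEnd ℂ) (Complex.exp (Complex.I * (t : ℂ))) = 1 := by
  rw [← Complex.exp_conj, ← Complex.exp_add]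
  simp

theorem Complex.exp_neg_I_mul_ofReal_mul_conj (t : ℝ) :
    Complex.exp (-Complex.I * (t : ℂ)) * (starRingEnd ℂ) (Complex.exp (-Complex.I * (t : ℂ))) = 1 := by
  rw [← Complex.exp_conj, ← Complex.exp_add]
  simp

theorem HasDerivAt.cexp_const_mul_ofReal (r k : ℝ) (w : ℂ) (y : ℝ) :
    HasDerivAt (fun y' : ℝ => (r : ℂ) * Complex.exp (w * ((k * y' : ℝ) : ℂ)))
      ((r : ℂ) * (w * k) * Complex.exp (w * ((k * y : ℝ) : ℂ))) y := by
  have h : HasDerivAt (fun y' : ℝ => ((k * y' : ℝ) : ℂ)) ((k : ℝ) : ℂ) y := by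
    simpa using ((hasDerivAt_id y).const_mul k).ofReal_comp
  exact ((h.const_mul w).cexp.const_mul (r : ℂ)).congr_deriv (by ring)

/-- for all `(x,y) ∈ ℝ²`, `⟪F_x,F⟫ = 0` and `⟪F_y,F⟫ = 0`; i.e.
Mironov's immersion `F` is a Legendrian immersion into `S⁵`. -/
theorem mironov_is_legendrian
    (a b c : ℝ) (ha : 0 < a) (hb : 0 < b) (hc : 0 < c)
    (u φ ψ ζ : ℝ → ℝ)
    (hu : ∀ x : ℝ, u x = c * (a + b + (b - a) * Real.cos (2 * x)) / 2)
    (hφ : ∀ x : ℝ, φ x = Real.sqrt (c / (a + c)) * Real.sin x)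
    (hψ : ∀ x : ℝ, ψ x = Real.sqrt (c / (b + c)) * Real.cos x)
    (hζ : ∀ x : ℝ, ζ x = Real.sqrt ((a * b + u x) / ((a + c) * (b + c))))
    (F : ℝ → ℝ → Fin 3 → ℂ)
    (hF : ∀ x y : ℝ, F x y =
      ![(φ x : ℂ) * Complex.exp (Complex.I * ((a * y : ℝ) : ℂ)),
        (ψ x : ℂ) * Complex.exp (Complex.I * ((b * y : ℝ) : ℂ)),
        (ζ x : ℂ) * Complex.exp (-Complex.I * ((c * y : ℝ) : ℂ))])
    (Fx Fy : ℝ → ℝ → Fin 3 → ℂ)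
    (hFx : ∀ x y : ℝ, Fx x y = deriv (fun x' => F x' y) x)
    (hFy : ∀ x y : ℝ, Fy x y = deriv (fun y' => F x y') y) :
    ∀ x y : ℝ, herm (Fx x y) (F x y) = 0 ∧ herm (Fy x y) (F x y) = 0 := by
  have hac : 0 < a + c := by positivity
  have hbc : 0 < b + c := by positivity
  have hu' (x : ℝ) : u x = c * (b * Real.cos x ^ 2 + a * Real.sin x ^ 2) := by
    rw [hu, Real.cos_two_mul, Real.sin_sq]
    ring
  have hpos (x : ℝ) : 0 < (a * b + u x) / ((a + c) * (b + c)) := by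
    rw [hu']
    positivity
  have hφsq (x : ℝ) : φ x ^ 2 = c / (a + c) * Real.sin x ^ 2 := by
    rw [hφ, mul_pow, Real.sq_sqrt (by positivity)]
  have hψsq (x : ℝ) : ψ x ^ 2 = c / (b + c) * Real.cos x ^ 2 := by
    rw [hψ, mul_pow, Real.sq_sqrt (by positivity)]
  have hζsq (x : ℝ) : ζ x ^ 2 = (a * b + u x) / ((a + c) * (b + c)) := by
    rw [hζ, Real.sq_sqrt (hpos x).le]
  have hsphere (x : ℝ) : φ x ^ 2 + ψ x ^ 2 + ζ x ^ 2 = 1 := by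
    rw [hφsq, hψsq, hζsq, hu', Real.sin_sq]
    field_simp
    ring
  have hmoment (x : ℝ) : a * φ x ^ 2 + b * ψ x ^ 2 - c * ζ x ^ 2 = 0 := by
    rw [hφsq, hψsq, hζsq, hu', Real.sin_sq]
    field_simp
    ring
  have hφd : Differentiable ℝ φ := by
    rw [funext hφ]
    fun_prop
  have hψd : Differentiable ℝ ψ := by
    rw [funext hψ]
    fun_prop
  have hζd : Differentiable ℝ ζ := by
    have hud : Differentiable ℝ u := by
      rw [funext hu]
      fun_prop
    rw [funext hζ]
    intro x
    exact DifferentiableAt.sqrt (by fun_prop) (hpos x).ne'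
  intro x y
  have ea := Complex.exp_I_mul_ofReal_mul_conj (a * y)
  have eb := Complex.exp_I_mul_ofReal_mul_conj (b * y)
  have ec := Complex.exp_neg_I_mul_ofReal_mul_conj (c * y)
  constructor
  · have hderiv : φ x * deriv φ x + ψ x * deriv ψ x + ζ x * deriv ζ x = 0 := by
      have h := (((hφd x).hasDerivAt.pow 2).add ((hψd x).hasDerivAt.pow 2)).add
        ((hζd x).hasDerivAt.pow 2)
      have h' := h.unique ((hasDerivAt_const x (1 : ℝ)).congr_of_eventuallyEq
        (Filter.Eventually.of_forall hsphere))
      norm_num at h'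
      linarith
    have hderivC : (φ x : ℂ) * (deriv φ x : ℝ) + ψ x * (deriv ψ x : ℝ) + ζ x * (deriv ζ x : ℝ) = 0 := by
      exact_mod_cast hderiv
    have hD : Fx x y =
        ![((deriv φ x : ℝ) : ℂ) * Complex.exp (Complex.I * ((a * y : ℝ) : ℂ)),
          ((deriv ψ x : ℝ) : ℂ) * Complex.exp (Complex.I * ((b * y : ℝ) : ℂ)),
          ((deriv ζ x : ℝ) : ℂ) * Complex.exp (-Complex.I * ((c * y : ℝ) : ℂ))] := by
      rw [hFx]
      refine HasDerivAt.deriv (hasDerivAt_pi.2 fun i => ?_)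
      simp only [hF]
      fin_cases i
      · exact (hφd x).hasDerivAt.ofReal_comp.mul_const _
      · exact (hψd x).hasDerivAt.ofReal_comp.mul_const _
      · exact (hζd x).hasDerivAt.ofReal_comp.mul_const _
    rw [hD, hF, herm, Fin.sum_univ_three]
    simp only [Matrix.cons_val, map_mul, Complex.conj_ofReal]
    linear_combination hderivC + (φ x : ℂ) * (deriv φ x : ℝ) * ea +
      (ψ x : ℂ) * (deriv ψ x : ℝ) * eb + (ζ x : ℂ) * (deriv ζ x : ℝ) * ec
  · have hmomentC : (a : ℂ) * φ x ^ 2 + b * ψ x ^ 2 - c * ζ x ^ 2 = 0 := by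
      exact_mod_cast hmoment x
    have hD : Fy x y =
        ![(φ x : ℂ) * (Complex.I * a) * Complex.exp (Complex.I * ((a * y : ℝ) : ℂ)),
          (ψ x : ℂ) * (Complex.I * b) * Complex.exp (Complex.I * ((b * y : ℝ) : ℂ)),
          (ζ x : ℂ) * (-Complex.I * c) * Complex.exp (-Complex.I * ((c * y : ℝ) : ℂ))] := by
      rw [hFy]
      refine HasDerivAt.deriv (hasDerivAt_pi.2 fun i => ?_)
      simp only [hF]
      fin_cases i
      · exact HasDerivAt.cexp_const_mul_ofReal (φ x) a Complex.I y
      · exact HasDerivAt.cexp_const_mul_ofReal (ψ x) b Complex.I y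
      · exact HasDerivAt.cexp_const_mul_ofReal (ζ x) c (-Complex.I) y
    rw [hD, hF, herm, Fin.sum_univ_three]
    simp only [Matrix.cons_val, map_mul, Complex.conj_ofReal]
    linear_combination Complex.I * hmomentC + Complex.I * a * (φ x : ℂ) ^ 2 * ea +
      Complex.I * b * (ψ x : ℂ) ^ 2 * eb - Complex.I * c * (ζ x : ℂ) ^ 2 * ec
end

section
/- For all (x,y) ∈ ℝ², ⟪F_x, F_x⟫ = u(x)/(ab+u(x)), ⟪F_y, F_y⟫ = u(x), and ⟪F_x, F_y⟫ = 0. In particular F is an immersion and the induced metric is g = (u/(ab+u))dx² + u·dy². -/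
open Complex in
theorem hasDerivAt_amplitude_mul_phase {n : ℕ} {p : ℝ → Fin n → ℝ} {p' : Fin n → ℝ} {x : ℝ}
    (hp : ∀ j, HasDerivAt (fun t => p t j) (p' j) x) (w : Fin n → ℝ) (y : ℝ) :
    HasDerivAt (fun t j => (p t j : ℂ) * exp (I * ((w j * y : ℝ) : ℂ)))
      (fun j => (p' j : ℂ) * exp (I * ((w j * y : ℝ) : ℂ))) x :=
  hasDerivAt_pi.2 fun j => (hp j).ofReal_comp.mul_const _

open Complex in
theorem hasDerivAt_phase {n : ℕ} (p w : Fin n → ℝ) (y : ℝ) :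
    HasDerivAt (fun (t : ℝ) j => (p j : ℂ) * exp (I * ((w j * t : ℝ) : ℂ)))
      (fun j => (I * ((w j * p j : ℝ) : ℂ)) * exp (I * ((w j * y : ℝ) : ℂ))) y := by
  refine hasDerivAt_pi.2 fun j => ?_
  have h : HasDerivAt (fun t : ℝ => I * ((w j * t : ℝ) : ℂ)) (I * ((w j * 1 : ℝ) : ℂ)) y :=
    (((hasDerivAt_id y).const_mul (w j)).ofReal_comp).const_mul I
  refine (h.cexp.const_mul (p j : ℂ)).congr_deriv ?_
  push_cast
  ring

open Complex in
/-- The hermitian product is unchanged when both vectors are multiplied by the same phases. -/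
theorem herm_mul_phase {n : ℕ} (z w : Fin n → ℂ) (θ : Fin n → ℝ) :
    herm (fun j => z j * exp (I * (θ j : ℂ))) (fun j => w j * exp (I * (θ j : ℂ))) =
      herm z w := by
  refine Finset.sum_congr rfl fun j _ => ?_
  have h : exp (I * (θ j : ℂ)) * (starRingEnd ℂ) (exp (I * (θ j : ℂ))) = 1 := by
    rw [← exp_conj, ← exp_add, map_mul, conj_I, conj_ofReal]
    simp
  rw [map_mul]
  linear_combination z j * (starRingEnd ℂ) (w j) * h

/-- `⟪F_x,F_x⟫ = u/(ab+u)`, `⟪F_y,F_y⟫ = u` and `⟪F_x,F_y⟫ = 0`,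
so the induced metric of Mironov's immersion is `g = (u/(ab+u))dx² + u·dy²`. -/
theorem mironov_induced_metric
    (a b c : ℝ) (ha : 0 < a) (hb : 0 < b) (hc : 0 < c)
    (u φ ψ ζ : ℝ → ℝ)
    (hu : ∀ x : ℝ, u x = c * (a + b + (b - a) * Real.cos (2 * x)) / 2)
    (hφ : ∀ x : ℝ, φ x = Real.sqrt (c / (a + c)) * Real.sin x)
    (hψ : ∀ x : ℝ, ψ x = Real.sqrt (c / (b + c)) * Real.cos x)
    (hζ : ∀ x : ℝ, ζ x = Real.sqrt ((a * b + u x) / ((a + c) * (b + c))))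
    (F : ℝ → ℝ → Fin 3 → ℂ)
    (hF : ∀ x y : ℝ, F x y =
      ![(φ x : ℂ) * Complex.exp (Complex.I * ((a * y : ℝ) : ℂ)),
        (ψ x : ℂ) * Complex.exp (Complex.I * ((b * y : ℝ) : ℂ)),
        (ζ x : ℂ) * Complex.exp (-Complex.I * ((c * y : ℝ) : ℂ))])
    (Fx Fy : ℝ → ℝ → Fin 3 → ℂ)
    (hFx : ∀ x y : ℝ, Fx x y = deriv (fun x' => F x' y) x)
    (hFy : ∀ x y : ℝ, Fy x y = deriv (fun y' => F x y') y) :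
    ∀ x y : ℝ, herm (Fx x y) (Fx x y) = ((u x / (a * b + u x) : ℝ) : ℂ) ∧
      herm (Fy x y) (Fy x y) = ((u x : ℝ) : ℂ) ∧
      herm (Fx x y) (Fy x y) = 0 := by
  intro x y
  have hu' : ∀ t, u t = c * (a * Real.sin t ^ 2 + b * Real.cos t ^ 2) := fun t => by
    rw [hu, Real.cos_two_mul]
    linear_combination -c * a * Real.sin_sq_add_cos_sq t
  have hupos : 0 < a * b + u x := by
    rw [hu']
    positivity
  have hpos : 0 < (a * b + u x) / ((a + c) * (b + c)) := by positivity
  have hdu : HasDerivAt u (2 * c * (a - b) * Real.sin x * Real.cos x) x := by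
    rw [funext hu']
    refine (((((Real.hasDerivAt_sin x).pow 2).const_mul a).add
      (((Real.hasDerivAt_cos x).pow 2).const_mul b)).const_mul c).congr_deriv ?_
    push_cast
    ring
  set p : ℝ → Fin 3 → ℝ := fun t => ![φ t, ψ t, ζ t] with hp
  set ζ' : ℝ := 2 * c * (a - b) * Real.sin x * Real.cos x / ((a + c) * (b + c)) / (2 * ζ x)
    with hζ'
  set p' : Fin 3 → ℝ :=
    ![√(c / (a + c)) * Real.cos x, √(c / (b + c)) * -Real.sin x, ζ'] with hp'
  set w : Fin 3 → ℝ := ![a, b, -c] with hw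
  have hdp : ∀ j, HasDerivAt (fun t => p t j) (p' j) x := by
    intro j
    fin_cases j
    · simpa [hp, hp', funext hφ] using (Real.hasDerivAt_sin x).const_mul √(c / (a + c))
    · simpa [hp, hp', funext hψ] using (Real.hasDerivAt_cos x).const_mul √(c / (b + c))
    · have h := ((hdu.const_add (a * b)).div_const ((a + c) * (b + c))).sqrt hpos.ne'
      rw [← hζ x, ← hζ'] at h
      simpa [hp, hp', funext hζ] using h
  have hFp : F = fun t s j => (p t j : ℂ) * Complex.exp (Complex.I * ((w j * s : ℝ) : ℂ)) := by
    funext t s j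
    rw [hF]
    fin_cases j <;> simp [hp, hw]
  have hφ2 : √(c / (a + c)) ^ 2 = c / (a + c) := Real.sq_sqrt (by positivity)
  have hψ2 : √(c / (b + c)) ^ 2 = c / (b + c) := Real.sq_sqrt (by positivity)
  have hζ2 : ζ x ^ 2 = (a * b + u x) / ((a + c) * (b + c)) := by
    rw [hζ, Real.sq_sqrt hpos.le]
  have hζ0 : ζ x ≠ 0 := by
    rw [hζ]
    exact (Real.sqrt_pos.2 hpos).ne'
  have hζζ' : ζ' * ζ x = c * (a - b) * Real.sin x * Real.cos x / ((a + c) * (b + c)) := by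
    rw [hζ']
    field_simp
  have hcos : Real.cos x ^ 2 = 1 - Real.sin x ^ 2 := Real.cos_sq' x
  rw [hFx, hFy, hFp, (hasDerivAt_amplitude_mul_phase hdp w y).deriv,
    (hasDerivAt_phase (p x) w y).deriv, herm_mul_phase, herm_mul_phase, herm_mul_phase]
  refine ⟨?_, ?_, ?_⟩
  · have key : p' 0 ^ 2 + p' 1 ^ 2 + p' 2 ^ 2 = u x / (a * b + u x) := by
      have hζ'2 : ζ' ^ 2 = (c * (a - b) * Real.sin x * Real.cos x) ^ 2 /
          ((a + c) * (b + c) * (a * b + u x)) := by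
        have h : ζ' ^ 2 = (ζ' * ζ x) ^ 2 / ζ x ^ 2 := by field_simp
        rw [h, hζζ', hζ2]
        field_simp
      simp only [hp', Matrix.cons_val]
      rw [mul_pow, mul_pow, hφ2, hψ2, hζ'2]
      field_simp
      rw [hu', hcos]
      ring
    rw [← key]
    simp [herm, Fin.sum_univ_three, sq]
  · have key : (w 0 * p x 0) ^ 2 + (w 1 * p x 1) ^ 2 + (w 2 * p x 2) ^ 2 = u x := by
      simp only [hp, hw, Matrix.cons_val]
      rw [mul_pow, mul_pow, mul_pow, hζ2, hφ, hψ, mul_pow, mul_pow, hφ2, hψ2]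
      field_simp
      rw [hu', hcos]
      ring
    rw [← key]
    simp only [herm, Fin.sum_univ_three, map_mul, Complex.conj_I, Complex.conj_ofReal]
    push_cast
    linear_combination (-((w 0 * p x 0) ^ 2 + (w 1 * p x 1) ^ 2 + (w 2 * p x 2) ^ 2) : ℂ) *
      Complex.I_sq
  · have key : p' 0 * (w 0 * p x 0) + p' 1 * (w 1 * p x 1) + p' 2 * (w 2 * p x 2) = 0 := by
      simp only [hp, hp', hw, Matrix.cons_val]
      rw [hφ, hψ]
      have e : √(c / (a + c)) * Real.cos x * (a * (√(c / (a + c)) * Real.sin x)) +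
          √(c / (b + c)) * -Real.sin x * (b * (√(c / (b + c)) * Real.cos x)) +
          ζ' * (-c * ζ x) =
        √(c / (a + c)) ^ 2 * (a * Real.sin x * Real.cos x) -
          √(c / (b + c)) ^ 2 * (b * Real.sin x * Real.cos x) - c * (ζ' * ζ x) := by ring
      rw [e, hφ2, hψ2, hζζ']
      field_simp
      ring
    have keyC := congrArg (fun r : ℝ => (r : ℂ)) key
    simp only [herm, Fin.sum_univ_three, map_mul, Complex.conj_I, Complex.conj_ofReal]
    push_cast at keyC ⊢
    linear_combination -Complex.I * keyC
end

section
/- The components of the second fundamental form of Mironov's immersion along the normal i·F_x are: Re⟪F_xx, i·F_x⟫ = 0, Re⟪F_yy, i·F_x⟫ = 0, and Re⟪F_xy, i·F_x⟫ = abc/(ab+u(x)), at every point of ℝ². -/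
/-- The derivative of a curve in `ℂⁿ` whose components are real functions with constant complex
coefficients. -/
lemma deriv_ofReal_mul_pi {n : ℕ} {p : Fin n → ℝ → ℝ} (hp : ∀ j, Differentiable ℝ (p j))
    (e : Fin n → ℂ) (x : ℝ) :
    deriv (fun t j => (p j t : ℂ) * e j) x = fun j => ((deriv (p j) x : ℝ) : ℂ) * e j := by
  refine (hasDerivAt_pi.2 fun j => ?_).deriv
  exact (hp j x).hasDerivAt.ofReal_comp.mul_const (e j)

/-- The derivative of a curve in `ℂⁿ` whose components rotate with frequencies `k j`. -/
lemma deriv_mul_exp_pi {n : ℕ} (k : Fin n → ℝ) (z : Fin n → ℂ) (y : ℝ) :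
    deriv (fun t j => z j * Complex.exp (Complex.I * ((k j * t : ℝ) : ℂ))) y =
      fun j => Complex.I * k j * z j * Complex.exp (Complex.I * ((k j * y : ℝ) : ℂ)) := by
  refine (hasDerivAt_pi.2 fun j => ?_).deriv
  have h : HasDerivAt (fun t : ℝ => k j * t) (k j) y := by
    simpa using (hasDerivAt_id y).const_mul (k j)
  have h' := ((h.ofReal_comp.const_mul Complex.I).cexp).const_mul (z j)
  refine h'.congr_deriv ?_
  ring

/-- Phase factors cancel in the hermitian inner product with `i` times a vector. -/
lemma herm_mul_exp_I_mul {n : ℕ} (z : Fin n → ℂ) (w θ : Fin n → ℝ) :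
    herm (fun j => z j * Complex.exp (Complex.I * (θ j : ℂ)))
        (fun j => Complex.I * ((w j : ℂ) * Complex.exp (Complex.I * (θ j : ℂ)))) =
      ∑ j, -Complex.I * z j * w j := by
  refine Finset.sum_congr rfl fun j _ => ?_
  have h : Complex.exp (Complex.I * (θ j : ℂ)) * Complex.exp (-Complex.I * (θ j : ℂ)) = 1 := by
    rw [← Complex.exp_add]; simp
  simp only [map_mul, Complex.conj_I, Complex.conj_ofReal, ← Complex.exp_conj]
  linear_combination (-Complex.I * z j * w j) * h

/-- The components of the second fundamental form along `i·F_x` of an immersion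
`F_j(x,y) = p_j(x) e^{i k_j y}`. -/
lemma re_herm_rotational {n : ℕ} {p : Fin n → ℝ → ℝ} (k : Fin n → ℝ)
    (hp : ∀ j, Differentiable ℝ (p j)) (hp' : ∀ j, Differentiable ℝ (deriv (p j)))
    {F Fx Fy Fxx Fxy Fyy : ℝ → ℝ → Fin n → ℂ}
    (hF : ∀ x y, F x y =
      fun j => (p j x : ℂ) * Complex.exp (Complex.I * ((k j * y : ℝ) : ℂ)))
    (hFx : ∀ x y : ℝ, Fx x y = deriv (fun x' => F x' y) x)
    (hFy : ∀ x y : ℝ, Fy x y = deriv (fun y' => F x y') y)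
    (hFxx : ∀ x y : ℝ, Fxx x y = deriv (fun x' => Fx x' y) x)
    (hFxy : ∀ x y : ℝ, Fxy x y = deriv (fun y' => Fx x y') y)
    (hFyy : ∀ x y : ℝ, Fyy x y = deriv (fun y' => Fy x y') y) (x y : ℝ) :
    (herm (Fxx x y) (fun j => Complex.I * Fx x y j)).re = 0 ∧
      (herm (Fyy x y) (fun j => Complex.I * Fx x y j)).re = 0 ∧
      (herm (Fxy x y) (fun j => Complex.I * Fx x y j)).re = ∑ j, k j * deriv (p j) x ^ 2 := by
  have hX : ∀ x y, Fx x y = fun j =>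
      ((deriv (p j) x : ℝ) : ℂ) * Complex.exp (Complex.I * ((k j * y : ℝ) : ℂ)) := fun x y => by
    simp only [hFx, hF]
    exact deriv_ofReal_mul_pi hp _ x
  have hY : ∀ x y, Fy x y = fun j =>
      Complex.I * k j * p j x * Complex.exp (Complex.I * ((k j * y : ℝ) : ℂ)) := fun x y => by
    simp only [hFy, hF]
    exact deriv_mul_exp_pi k _ y
  have hXX : Fxx x y = fun j =>
      ((deriv (deriv (p j)) x : ℝ) : ℂ) *
        Complex.exp (Complex.I * ((k j * y : ℝ) : ℂ)) := by
    simp only [hFxx, hX]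
    exact deriv_ofReal_mul_pi hp' _ x
  have hXY : Fxy x y = fun j => Complex.I * k j * ((deriv (p j) x : ℝ) : ℂ) *
      Complex.exp (Complex.I * ((k j * y : ℝ) : ℂ)) := by
    simp only [hFxy, hX]
    exact deriv_mul_exp_pi k _ y
  have hYY : Fyy x y = fun j => Complex.I * k j * (Complex.I * k j * p j x) *
      Complex.exp (Complex.I * ((k j * y : ℝ) : ℂ)) := by
    simp only [hFyy, hY]
    exact deriv_mul_exp_pi k _ y
  rw [hXX, hXY, hYY, hX x y]
  refine ⟨?_, ?_, ?_⟩ <;> rw [herm_mul_exp_I_mul, Complex.re_sum]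
  · exact Finset.sum_eq_zero fun j _ => by simp
  · exact Finset.sum_eq_zero fun j _ => by simp
  · refine Finset.sum_congr rfl fun j _ => ?_
    simp
    ring

/-- the components of the second fundamental form of Mironov's
immersion along the normal `i·F_x`: `Re⟪F_xx, i·F_x⟫ = 0`, `Re⟪F_yy, i·F_x⟫ = 0`
and `Re⟪F_xy, i·F_x⟫ = abc/(ab+u(x))`. -/
theorem mironov_second_fundamental_form_iFx
    (a b c : ℝ) (ha : 0 < a) (hb : 0 < b) (hc : 0 < c)
    (u φ ψ ζ : ℝ → ℝ)
    (hu : ∀ x : ℝ, u x = c * (a + b + (b - a) * Real.cos (2 * x)) / 2)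
    (hφ : ∀ x : ℝ, φ x = Real.sqrt (c / (a + c)) * Real.sin x)
    (hψ : ∀ x : ℝ, ψ x = Real.sqrt (c / (b + c)) * Real.cos x)
    (hζ : ∀ x : ℝ, ζ x = Real.sqrt ((a * b + u x) / ((a + c) * (b + c))))
    (F : ℝ → ℝ → Fin 3 → ℂ)
    (hF : ∀ x y : ℝ, F x y =
      ![(φ x : ℂ) * Complex.exp (Complex.I * ((a * y : ℝ) : ℂ)),
        (ψ x : ℂ) * Complex.exp (Complex.I * ((b * y : ℝ) : ℂ)),
        (ζ x : ℂ) * Complex.exp (-Complex.I * ((c * y : ℝ) : ℂ))])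
    (Fx Fy Fxx Fxy Fyy : ℝ → ℝ → Fin 3 → ℂ)
    (hFx : ∀ x y : ℝ, Fx x y = deriv (fun x' => F x' y) x)
    (hFy : ∀ x y : ℝ, Fy x y = deriv (fun y' => F x y') y)
    (hFxx : ∀ x y : ℝ, Fxx x y = deriv (fun x' => Fx x' y) x)
    (hFxy : ∀ x y : ℝ, Fxy x y = deriv (fun y' => Fx x y') y)
    (hFyy : ∀ x y : ℝ, Fyy x y = deriv (fun y' => Fy x y') y) :
    ∀ x y : ℝ,
      (herm (Fxx x y) (fun j => Complex.I * Fx x y j)).re = 0 ∧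
      (herm (Fyy x y) (fun j => Complex.I * Fx x y j)).re = 0 ∧
      (herm (Fxy x y) (fun j => Complex.I * Fx x y j)).re = a * b * c / (a * b + u x) := by
  have hu' : ∀ x, u x = c * (b * Real.cos x ^ 2 + a * Real.sin x ^ 2) := fun x => by
    rw [hu, Real.cos_two_mul]
    linear_combination (-a * c) * Real.sin_sq_add_cos_sq x
  have hpos : ∀ x, 0 < a * b + u x := fun x => by rw [hu']; positivity
  have hφ' : φ = fun x => Real.sqrt (c / (a + c)) * Real.sin x := funext hφ
  have hψ' : ψ = fun x => Real.sqrt (c / (b + c)) * Real.cos x := funext hψ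
  have hφC : ContDiff ℝ 2 φ := by rw [hφ']; fun_prop
  have hψC : ContDiff ℝ 2 ψ := by rw [hψ']; fun_prop
  have huC : ContDiff ℝ 2 u := by rw [funext hu']; fun_prop
  have hζpos : ∀ x, 0 < (a * b + u x) / ((a + c) * (b + c)) := fun x =>
    div_pos (hpos x) (by positivity)
  have hζC : ContDiff ℝ 2 ζ := by
    rw [funext hζ]
    exact ((contDiff_const.add huC).div_const _).sqrt fun x => (hζpos x).ne'
  have hC : ∀ j, ContDiff ℝ 2 ((![φ, ψ, ζ] : Fin 3 → ℝ → ℝ) j) := by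
    intro j
    fin_cases j
    exacts [hφC, hψC, hζC]
  have hF' : ∀ x y, F x y = fun j => (((![φ, ψ, ζ] : Fin 3 → ℝ → ℝ) j x : ℝ) : ℂ) *
      Complex.exp (Complex.I * (((![a, b, -c] : Fin 3 → ℝ) j * y : ℝ) : ℂ)) := fun x y => by
    rw [hF]
    funext j
    fin_cases j <;> simp
  intro x y
  obtain ⟨hxx, hyy, hxy⟩ := re_herm_rotational ![a, b, -c]
    (fun j => (hC j).differentiable two_ne_zero)
    (fun j => ((contDiff_succ_iff_deriv (n := 1)).1 (hC j)).2.2.differentiable one_ne_zero)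
    hF' hFx hFy hFxx hFxy hFyy x y
  refine ⟨hxx, hyy, hxy.trans ?_⟩
  have hdφ : deriv φ x ^ 2 = c / (a + c) * Real.cos x ^ 2 := by
    rw [hφ', ((Real.hasDerivAt_sin x).const_mul _).deriv, mul_pow, Real.sq_sqrt (by positivity)]
  have hdψ : deriv ψ x ^ 2 = c / (b + c) * Real.sin x ^ 2 := by
    rw [hψ', ((Real.hasDerivAt_cos x).const_mul _).deriv, mul_pow, Real.sq_sqrt (by positivity),
      neg_sq]
  have hdu : HasDerivAt u (2 * c * (a - b) * (Real.sin x * Real.cos x)) x := by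
    rw [funext hu']
    refine (((((Real.hasDerivAt_cos x).pow 2).const_mul b).add
      (((Real.hasDerivAt_sin x).pow 2).const_mul a)).const_mul c).congr_deriv ?_
    push_cast
    ring
  have hdζ : deriv ζ x ^ 2 = c ^ 2 * (a - b) ^ 2 * (Real.sin x ^ 2 * Real.cos x ^ 2) /
      ((a + c) * (b + c) * (a * b + u x)) := by
    rw [funext hζ, (((hdu.const_add (a * b)).div_const _).sqrt (hζpos x).ne').deriv, div_pow,
      mul_pow 2, Real.sq_sqrt (hζpos x).le]
    have := (hpos x).ne'
    field_simp
  simp only [Fin.sum_univ_three, Matrix.cons_val]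
  rw [hdφ, hdψ, hdζ]
  have h0 := (hpos x).ne'
  have h1 : Real.cos x ^ 2 = 1 - Real.sin x ^ 2 := by
    linear_combination Real.sin_sq_add_cos_sq x
  field_simp
  rw [hu', h1]
  ring
end

section
/- The components of the second fundamental form of Mironov's immersion along the normal i·F_y are: Re⟪F_xx, i·F_y⟫ = abc/(ab+u(x)), Re⟪F_xy, i·F_y⟫ = 0, and Re⟪F_yy, i·F_y⟫ = (a+b−c)·u(x) − abc, at every point of ℝ². -/
/-- The map `(x, y) ↦ (pⱼ(x) · exp(i kⱼ y))ⱼ`. -/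
noncomputable def wave {n : ℕ} (k : Fin n → ℝ) (p : ℝ → Fin n → ℂ) (x y : ℝ) : Fin n → ℂ :=
  fun j => p x j * Complex.exp (Complex.I * (k j * y))

theorem deriv_wave_left {n : ℕ} (k : Fin n → ℝ) {p p' : ℝ → Fin n → ℂ} {x : ℝ} (y : ℝ)
    (hp : ∀ j, HasDerivAt (fun t => p t j) (p' x j) x) :
    deriv (fun t => wave k p t y) x = wave k p' x y := by
  refine HasDerivAt.deriv (hasDerivAt_pi.2 fun j => ?_)
  exact (hp j).mul_const _

theorem deriv_wave_right {n : ℕ} (k : Fin n → ℝ) (p : ℝ → Fin n → ℂ) (x y : ℝ) :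
    deriv (fun t => wave k p x t) y = wave k (fun t j => Complex.I * k j * p t j) x y := by
  refine HasDerivAt.deriv (hasDerivAt_pi.2 fun j => ?_)
  have h : HasDerivAt (fun t : ℝ => Complex.I * ((k j : ℂ) * (t : ℂ)))
      (Complex.I * ((k j : ℂ) * 1)) y :=
    (((hasDerivAt_id y).ofReal_comp).const_mul _).const_mul _
  refine (h.cexp.const_mul (p x j)).congr_deriv ?_
  simp only [wave]
  ring

theorem herm_wave {n : ℕ} (k : Fin n → ℝ) (p q : ℝ → Fin n → ℂ) (x y : ℝ) :
    herm (wave k p x y)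
        (fun j => Complex.I * wave k (fun t j => Complex.I * k j * q t j) x y j) =
      -∑ j, k j * (p x j * (starRingEnd ℂ) (q x j)) := by
  rw [herm, ← Finset.sum_neg_distrib]
  refine Finset.sum_congr rfl fun j _ => ?_
  have h : Complex.exp (Complex.I * (k j * y)) *
      (starRingEnd ℂ) (Complex.exp (Complex.I * (k j * y))) = 1 := by
    rw [← Complex.exp_conj, ← Complex.exp_add]
    simp
  simp only [wave, map_mul, Complex.conj_I, Complex.conj_ofReal]
  linear_combination (k j * p x j * (starRingEnd ℂ) (q x j)) * Complex.I ^ 2 * h +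
    (k j * p x j * (starRingEnd ℂ) (q x j)) * Complex.I_sq

/-- the components of the second fundamental form of Mironov's
immersion along the normal `i·F_y`: `Re⟪F_xx, i·F_y⟫ = abc/(ab+u(x))`,
`Re⟪F_xy, i·F_y⟫ = 0` and `Re⟪F_yy, i·F_y⟫ = (a+b−c)·u(x) − abc`. -/
theorem mironov_second_fundamental_form_iFy
    (a b c : ℝ) (ha : 0 < a) (hb : 0 < b) (hc : 0 < c)
    (u φ ψ ζ : ℝ → ℝ)
    (hu : ∀ x : ℝ, u x = c * (a + b + (b - a) * Real.cos (2 * x)) / 2)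
    (hφ : ∀ x : ℝ, φ x = Real.sqrt (c / (a + c)) * Real.sin x)
    (hψ : ∀ x : ℝ, ψ x = Real.sqrt (c / (b + c)) * Real.cos x)
    (hζ : ∀ x : ℝ, ζ x = Real.sqrt ((a * b + u x) / ((a + c) * (b + c))))
    (F : ℝ → ℝ → Fin 3 → ℂ)
    (hF : ∀ x y : ℝ, F x y =
      ![(φ x : ℂ) * Complex.exp (Complex.I * ((a * y : ℝ) : ℂ)),
        (ψ x : ℂ) * Complex.exp (Complex.I * ((b * y : ℝ) : ℂ)),
        (ζ x : ℂ) * Complex.exp (-Complex.I * ((c * y : ℝ) : ℂ))])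
    (Fx Fy Fxx Fxy Fyy : ℝ → ℝ → Fin 3 → ℂ)
    (hFx : ∀ x y : ℝ, Fx x y = deriv (fun x' => F x' y) x)
    (hFy : ∀ x y : ℝ, Fy x y = deriv (fun y' => F x y') y)
    (hFxx : ∀ x y : ℝ, Fxx x y = deriv (fun x' => Fx x' y) x)
    (hFxy : ∀ x y : ℝ, Fxy x y = deriv (fun y' => Fx x y') y)
    (hFyy : ∀ x y : ℝ, Fyy x y = deriv (fun y' => Fy x y') y) :
    ∀ x y : ℝ,
      (herm (Fxx x y) (fun j => Complex.I * Fy x y j)).re = a * b * c / (a * b + u x) ∧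
      (herm (Fxy x y) (fun j => Complex.I * Fy x y j)).re = 0 ∧
      (herm (Fyy x y) (fun j => Complex.I * Fy x y j)).re = (a + b - c) * u x - a * b * c := by
  have hac : 0 < a + c := by positivity
  have hbc : 0 < b + c := by positivity
  have hu' (x : ℝ) : u x = c * (a * Real.sin x ^ 2 + b * Real.cos x ^ 2) := by
    rw [hu, Real.cos_two_mul]
    linear_combination -(c * a) * Real.sin_sq_add_cos_sq x
  have hG (x : ℝ) : 0 < a * b + u x := by
    rw [hu']
    positivity
  set K := (a + c) * (b + c) with hK
  have hKpos : 0 < K := by positivity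
  have hζpos (x : ℝ) : 0 < ζ x := by
    rw [hζ]
    exact Real.sqrt_pos.2 (div_pos (hG x) hKpos)
  have hζsq (x : ℝ) : ζ x ^ 2 = (a * b + u x) / K := by
    rw [hζ, Real.sq_sqrt (div_pos (hG x) hKpos).le]
  have hφsq (x : ℝ) : φ x ^ 2 = c / (a + c) * Real.sin x ^ 2 := by
    rw [hφ, mul_pow, Real.sq_sqrt (by positivity)]
  have hψsq (x : ℝ) : ψ x ^ 2 = c / (b + c) * Real.cos x ^ 2 := by
    rw [hψ, mul_pow, Real.sq_sqrt (by positivity)]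
  let w : ℝ → ℝ := fun x => c * (a - b) * (Real.sin x * Real.cos x) / K
  let w' : ℝ → ℝ := fun x => c * (a - b) * (Real.cos x ^ 2 - Real.sin x ^ 2) / K
  let φ' : ℝ → ℝ := fun x => Real.sqrt (c / (a + c)) * Real.cos x
  let ψ' : ℝ → ℝ := fun x => -(Real.sqrt (c / (b + c)) * Real.sin x)
  let ζ' : ℝ → ℝ := fun x => w x / ζ x
  let ζ'' : ℝ → ℝ := fun x => (w' x * ζ x - w x * ζ' x) / ζ x ^ 2
  have dw (x : ℝ) : HasDerivAt w (w' x) x := by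
    refine ((((Real.hasDerivAt_sin x).mul (Real.hasDerivAt_cos x)).const_mul
      (c * (a - b))).div_const K).congr_deriv ?_
    simp only [w']
    ring
  have dφ (x : ℝ) : HasDerivAt φ (φ' x) x := by
    rw [funext hφ]
    exact (Real.hasDerivAt_sin x).const_mul _
  have dφ' (x : ℝ) : HasDerivAt φ' (-φ x) x := by
    rw [hφ, ← mul_neg]
    exact (Real.hasDerivAt_cos x).const_mul _
  have dψ (x : ℝ) : HasDerivAt ψ (ψ' x) x := by
    rw [funext hψ]
    simp only [ψ', ← mul_neg]
    exact (Real.hasDerivAt_cos x).const_mul _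
  have dψ' (x : ℝ) : HasDerivAt ψ' (-ψ x) x := by
    rw [hψ]
    exact ((Real.hasDerivAt_sin x).const_mul _).neg
  have dζ (x : ℝ) : HasDerivAt ζ (ζ' x) x := by
    have hd : HasDerivAt (fun t => (a * b + u t) / K) (2 * w x) x := by
      simp only [hu']
      refine (((((((Real.hasDerivAt_sin x).pow 2).const_mul a).add
        (((Real.hasDerivAt_cos x).pow 2).const_mul b)).const_mul c).const_add
        (a * b)).div_const K).congr_deriv ?_
      simp only [w]
      push_cast
      ring
    have hs := hd.sqrt (div_pos (hG x) hKpos).ne'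
    rw [← hζ, ← funext hζ] at hs
    convert hs using 1
    simp only [ζ']
    rw [mul_div_mul_left _ _ two_ne_zero]
  have dζ' (x : ℝ) : HasDerivAt ζ' (ζ'' x) x := (dw x).div (dζ x) (hζpos x).ne'
  let k : Fin 3 → ℝ := ![a, b, -c]
  let p : ℝ → Fin 3 → ℂ := fun x => ![(φ x : ℂ), (ψ x : ℂ), (ζ x : ℂ)]
  let p' : ℝ → Fin 3 → ℂ := fun x => ![(φ' x : ℂ), (ψ' x : ℂ), (ζ' x : ℂ)]
  let p'' : ℝ → Fin 3 → ℂ := fun x => ![((-φ x : ℝ) : ℂ), ((-ψ x : ℝ) : ℂ), (ζ'' x : ℂ)]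
  have eF : F = wave k p := by
    funext x y j
    rw [hF]
    fin_cases j <;> simp [wave, k, p]
  have eFx : Fx = wave k p' := by
    funext x y
    rw [hFx, eF]
    refine deriv_wave_left k y fun j => ?_
    fin_cases j
    · exact (dφ x).ofReal_comp
    · exact (dψ x).ofReal_comp
    · exact (dζ x).ofReal_comp
  have eFxx : Fxx = wave k p'' := by
    funext x y
    rw [hFxx, eFx]
    refine deriv_wave_left k y fun j => ?_
    fin_cases j
    · exact (dφ' x).ofReal_comp
    · exact (dψ' x).ofReal_comp
    · exact (dζ' x).ofReal_comp
  have eFy : Fy = wave k (fun t j => Complex.I * k j * p t j) := by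
    funext x y
    rw [hFy, eF, deriv_wave_right]
  have eFxy : Fxy = wave k (fun t j => Complex.I * k j * p' t j) := by
    funext x y
    rw [hFxy, eFx, deriv_wave_right]
  have eFyy : Fyy = wave k (fun t j => Complex.I * k j * (Complex.I * k j * p t j)) := by
    funext x y
    rw [hFyy, eFy, deriv_wave_right]
  intro x y
  have hs : Real.sin x ^ 2 = 1 - Real.cos x ^ 2 := Real.sin_sq x
  refine ⟨?_, ?_, ?_⟩
  · rw [eFxx, eFy, herm_wave]
    have e1 : (-∑ j, (k j : ℂ) * (p'' x j * (starRingEnd ℂ) (p x j))).re =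
        a * φ x ^ 2 + b * ψ x ^ 2 + c * (ζ'' x * ζ x) := by
      simp [Fin.sum_univ_three, k, p, p'']
      ring
    have e2 : ζ'' x * ζ x = w' x - w x ^ 2 / ζ x ^ 2 := by
      have := (hζpos x).ne'
      simp only [ζ'', ζ']
      field_simp
    obtain ⟨D, hD⟩ : ∃ D, D = a * b + u x := ⟨_, rfl⟩
    have hD0 : D ≠ 0 := hD ▸ (hG x).ne'
    rw [e1, e2, hφsq, hψsq, hζsq, ← hD]
    simp only [w, w', hK]
    simp only [mul_pow, div_pow, hs]
    field_simp
    rw [hD, hu', hs]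
    ring
  · rw [eFxy, eFy, herm_wave]
    simp [Fin.sum_univ_three, k, p, p']
  · rw [eFyy, eFy, herm_wave]
    have e1 : (-∑ j, (k j : ℂ) * (Complex.I * k j * (Complex.I * k j * p x j) *
        (starRingEnd ℂ) (p x j))).re =
        a ^ 3 * φ x ^ 2 + b ^ 3 * ψ x ^ 2 - c ^ 3 * ζ x ^ 2 := by
      simp [Fin.sum_univ_three, k, p]
      ring
    rw [e1, hφsq, hψsq, hζsq, hK, hu', hs]
    field_simp
    ring
end

section
/- Mironov's immersion satisfies the mean curvature identity √(ab+u(x))·∂_x(√(ab+u(x))·F_x(x,y)) + F_yy(x,y) + 2u(x)·F(x,y) = (a+b−c)·(i·F_y(x,y)) for all (x,y) ∈ ℝ². (The left-hand side equals u times the Laplace–Beltrami operator of the induced metric g = (u/(ab+u))dx² + u·dy² applied to F, plus 2uF; hence the mean curvature vector of F as a surface in S⁵ is H = ((a+b−c)/u)·i·F_y, which is nowhere zero when a+b−c ≠ 0.) -/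
theorem hasDerivAt_cexp_I_mul (m y : ℝ) :
    HasDerivAt (fun y : ℝ => Complex.exp (Complex.I * ((m * y : ℝ) : ℂ)))
      (Complex.I * m * Complex.exp (Complex.I * ((m * y : ℝ) : ℂ))) y := by
  have h : HasDerivAt (fun y : ℝ => Complex.I * ((m * y : ℝ) : ℂ)) (Complex.I * m) y := by
    simpa using (((hasDerivAt_id y).const_mul m).ofReal_comp).const_mul Complex.I
  simpa [mul_comm] using h.cexp

/-- For a map whose components are separated as `p j x * exp (i m j y)`, an identity between
`∂ₓ` and `∂_y` derivatives reduces to a second order equation for each profile `p j`. -/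
theorem separated_mean_curvature {ι : Type*} [Fintype ι] (k : ℝ) (S u : ℝ → ℝ)
    (p p' q : ι → ℝ → ℝ) (m : ι → ℝ)
    (hp : ∀ j x, HasDerivAt (p j) (p' j x) x)
    (hq : ∀ j x, HasDerivAt (fun x => S x * p' j x) (q j x) x)
    (hode : ∀ j x, S x * q j x - m j ^ 2 * p j x + 2 * u x * p j x = -(k * m j * p j x))
    (F Fx Fy Fyy : ℝ → ℝ → ι → ℂ)
    (hF : ∀ x y j, F x y j = (p j x : ℂ) * Complex.exp (Complex.I * ((m j * y : ℝ) : ℂ)))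
    (hFx : ∀ x y, Fx x y = deriv (fun x' => F x' y) x)
    (hFy : ∀ x y, Fy x y = deriv (fun y' => F x y') y)
    (hFyy : ∀ x y, Fyy x y = deriv (fun y' => Fy x y') y) (x y : ℝ) (j : ι) :
    (S x : ℂ) * (deriv (fun x' => (fun j' => (S x' : ℂ) * Fx x' y j')) x) j +
      Fyy x y j + 2 * (u x : ℂ) * F x y j = (k : ℂ) * (Complex.I * Fy x y j) := by
  have eF : F = fun x y j => (p j x : ℂ) * Complex.exp (Complex.I * ((m j * y : ℝ) : ℂ)) := by
    funext x y j
    exact hF x y j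
  have eFx : ∀ x y, Fx x y =
      fun j => (p' j x : ℂ) * Complex.exp (Complex.I * ((m j * y : ℝ) : ℂ)) := by
    intro x y
    rw [hFx, eF]
    exact (hasDerivAt_pi.2 fun j => (hp j x).ofReal_comp.mul_const _).deriv
  have eFy : ∀ x y, Fy x y = fun j =>
      (p j x : ℂ) * (Complex.I * m j * Complex.exp (Complex.I * ((m j * y : ℝ) : ℂ))) := by
    intro x y
    rw [hFy, eF]
    exact (hasDerivAt_pi.2 fun j => (hasDerivAt_cexp_I_mul (m j) y).const_mul _).deriv
  have eFyy : Fyy x y = fun j => (p j x : ℂ) * (Complex.I * m j *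
      (Complex.I * m j * Complex.exp (Complex.I * ((m j * y : ℝ) : ℂ)))) := by
    rw [hFyy]
    simp only [eFy]
    exact (hasDerivAt_pi.2 fun j =>
      ((hasDerivAt_cexp_I_mul (m j) y).const_mul _).const_mul _).deriv
  have eS : deriv (fun x' => (fun j' => (S x' : ℂ) * Fx x' y j')) x =
      fun j => (q j x : ℂ) * Complex.exp (Complex.I * ((m j * y : ℝ) : ℂ)) := by
    simp only [eFx, ← mul_assoc, ← Complex.ofReal_mul (S _)]
    exact (hasDerivAt_pi.2 fun j => (hq j x).ofReal_comp.mul_const _).deriv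
  have h : (S x : ℂ) * q j x - (m j : ℂ) ^ 2 * p j x + 2 * u x * p j x =
      -(k * m j * p j x) := by
    exact_mod_cast hode j x
  rw [eS, eFyy, eFy, hF]
  linear_combination Complex.exp (Complex.I * ((m j * y : ℝ) : ℂ)) * h +
    Complex.exp (Complex.I * ((m j * y : ℝ) : ℂ)) * p j x * (m j ^ 2 - k * m j) * Complex.I_sq

/-- the mean curvature identity of Mironov's immersion:
`√(ab+u)·∂_x(√(ab+u)·F_x) + F_yy + 2u·F = (a+b−c)·(i·F_y)`, i.e. the mean
curvature vector of `F` as a surface in `S⁵` is `H = ((a+b−c)/u)·i·F_y`. -/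
theorem mironov_mean_curvature
    (a b c : ℝ) (ha : 0 < a) (hb : 0 < b) (hc : 0 < c)
    (u φ ψ ζ : ℝ → ℝ)
    (hu : ∀ x : ℝ, u x = c * (a + b + (b - a) * Real.cos (2 * x)) / 2)
    (hφ : ∀ x : ℝ, φ x = Real.sqrt (c / (a + c)) * Real.sin x)
    (hψ : ∀ x : ℝ, ψ x = Real.sqrt (c / (b + c)) * Real.cos x)
    (hζ : ∀ x : ℝ, ζ x = Real.sqrt ((a * b + u x) / ((a + c) * (b + c))))
    (F : ℝ → ℝ → Fin 3 → ℂ)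
    (hF : ∀ x y : ℝ, F x y =
      ![(φ x : ℂ) * Complex.exp (Complex.I * ((a * y : ℝ) : ℂ)),
        (ψ x : ℂ) * Complex.exp (Complex.I * ((b * y : ℝ) : ℂ)),
        (ζ x : ℂ) * Complex.exp (-Complex.I * ((c * y : ℝ) : ℂ))])
    (Fx Fy Fyy : ℝ → ℝ → Fin 3 → ℂ)
    (hFx : ∀ x y : ℝ, Fx x y = deriv (fun x' => F x' y) x)
    (hFy : ∀ x y : ℝ, Fy x y = deriv (fun y' => F x y') y)
    (hFyy : ∀ x y : ℝ, Fyy x y = deriv (fun y' => Fy x y') y) :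
    ∀ x y : ℝ, ∀ j : Fin 3,
      ((Real.sqrt (a * b + u x) : ℝ) : ℂ) *
          (deriv (fun x' => (fun j' => ((Real.sqrt (a * b + u x') : ℝ) : ℂ) * Fx x' y j')) x) j +
        Fyy x y j + 2 * ((u x : ℝ) : ℂ) * F x y j =
        ((a + b - c : ℝ) : ℂ) * (Complex.I * Fy x y j) := by
  have hu' : ∀ x, u x = c * (a * Real.sin x ^ 2 + b * Real.cos x ^ 2) := by
    intro x
    rw [hu, Real.cos_two_mul, Real.sin_sq]
    ring
  have hW : ∀ x, 0 < a * b + u x := by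
    intro x
    rw [hu']
    positivity
  have dW : ∀ x, HasDerivAt (fun x => a * b + u x)
      (2 * (c * (a - b) * (Real.sin x * Real.cos x))) x := by
    intro x
    rw [funext hu']
    refine ((((((Real.hasDerivAt_sin x).pow 2).const_mul a).add
      (((Real.hasDerivAt_cos x).pow 2).const_mul b)).const_mul c).const_add (a * b)).congr_deriv ?_
    simp
    ring
  have dS : ∀ x, HasDerivAt (fun x => Real.sqrt (a * b + u x))
      (c * (a - b) * (Real.sin x * Real.cos x) / Real.sqrt (a * b + u x)) x := by
    intro x
    refine ((dW x).sqrt (hW x).ne').congr_deriv ?_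
    rw [mul_div_mul_left _ _ two_ne_zero]
  have hS : ∀ x, Real.sqrt (a * b + u x) ≠ 0 := fun x => (Real.sqrt_pos.2 (hW x)).ne'
  have hSS : ∀ x, Real.sqrt (a * b + u x) ^ 2 = a * b + u x := fun x => Real.sq_sqrt (hW x).le
  have dsc : ∀ x, HasDerivAt (fun x => c * (a - b) * (Real.sin x * Real.cos x))
      (c * (a - b) * (Real.cos x ^ 2 - Real.sin x ^ 2)) x := by
    intro x
    refine (((Real.hasDerivAt_sin x).mul (Real.hasDerivAt_cos x)).const_mul _).congr_deriv ?_
    ring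
  obtain rfl : φ = fun x => Real.sqrt (c / (a + c)) * Real.sin x := funext hφ
  obtain rfl : ψ = fun x => Real.sqrt (c / (b + c)) * Real.cos x := funext hψ
  obtain rfl : ζ = fun x => Real.sqrt (a * b + u x) / Real.sqrt ((a + c) * (b + c)) := by
    funext x
    rw [hζ, Real.sqrt_div (hW x).le]
  refine separated_mean_curvature (a + b - c) (fun x => Real.sqrt (a * b + u x)) u
    ![fun x => Real.sqrt (c / (a + c)) * Real.sin x,
      fun x => Real.sqrt (c / (b + c)) * Real.cos x,
      fun x => Real.sqrt (a * b + u x) / Real.sqrt ((a + c) * (b + c))]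
    ![fun x => Real.sqrt (c / (a + c)) * Real.cos x,
      fun x => Real.sqrt (c / (b + c)) * -Real.sin x,
      fun x => c * (a - b) * (Real.sin x * Real.cos x) / Real.sqrt (a * b + u x) /
        Real.sqrt ((a + c) * (b + c))]
    ![fun x => c * (a - b) * (Real.sin x * Real.cos x) / Real.sqrt (a * b + u x) *
          (Real.sqrt (c / (a + c)) * Real.cos x) +
        Real.sqrt (a * b + u x) * (Real.sqrt (c / (a + c)) * -Real.sin x),
      fun x => c * (a - b) * (Real.sin x * Real.cos x) / Real.sqrt (a * b + u x) *
          (Real.sqrt (c / (b + c)) * -Real.sin x) +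
        Real.sqrt (a * b + u x) * (Real.sqrt (c / (b + c)) * -Real.cos x),
      fun x => c * (a - b) * (Real.cos x ^ 2 - Real.sin x ^ 2) / Real.sqrt ((a + c) * (b + c))]
    ![a, b, -c] ?_ ?_ ?_ F Fx Fy Fyy ?_ hFx hFy hFyy
  · intro j x
    fin_cases j
    · exact (Real.hasDerivAt_sin x).const_mul _
    · exact (Real.hasDerivAt_cos x).const_mul _
    · exact (dS x).div_const _
  · intro j x
    fin_cases j
    · exact (dS x).mul ((Real.hasDerivAt_cos x).const_mul _)
    · exact (dS x).mul ((Real.hasDerivAt_sin x).neg.const_mul _)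
    · refine ((dsc x).div_const _).congr_of_eventuallyEq (Filter.Eventually.of_forall fun x => ?_)
      have := hS x
      simp only [Fin.reduceFinMk, Matrix.cons_val]
      field_simp
  · intro j x
    have h0 := hS x
    have h2 := hSS x
    have h3 := hu' x
    have h4 := Real.sin_sq_add_cos_sq x
    have hcan : ∀ t, Real.sqrt (a * b + u x) * (t / Real.sqrt (a * b + u x)) = t :=
      fun t => mul_div_cancel₀ t h0
    fin_cases j
    · simp only [Fin.zero_eta, Matrix.cons_val]
      linear_combination
        Real.sqrt (c / (a + c)) * Real.cos x * hcan (c * (a - b) * (Real.sin x * Real.cos x)) +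
        Real.sqrt (c / (a + c)) * Real.sin x * (-h2 + h3 + c * a * h4)
    · simp only [Fin.mk_one, Matrix.cons_val]
      linear_combination
        -Real.sqrt (c / (b + c)) * Real.sin x * hcan (c * (a - b) * (Real.sin x * Real.cos x)) +
        Real.sqrt (c / (b + c)) * Real.cos x * (-h2 + h3 + c * b * h4)
    · simp only [Fin.reduceFinMk, Matrix.cons_val]
      linear_combination Real.sqrt (a * b + u x) / Real.sqrt ((a + c) * (b + c)) *
        (2 * h3 + c * (a + b) * h4)
  · intro x y j
    rw [hF]
    fin_cases j <;> simp
end
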